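/- arXiv:1710.07370 — 3 statements merged into one kernel-verified Lean document; each statement's English description precedes it below -/
import Mathlib

section
/- Let A and B be pretriangulated categories (triangulated categories with shift functor [1]) and let Φ : A → B be an exact functor (commuting with shifts up to natural isomorphism and sending distinguished triangles to distinguished triangles) which is fully faithful and admits a right adjoint Ψ : B → A. For any object b of B, complete the counit morphism ε_b : Φ(Ψ(b)) → b to a distinguished triangle Φ(Ψ(b)) → b → c → Φ(Ψ(b))[1]. Then Hom(Φ(a), c[p]) = 0 for every object a of A and every integer p. In particular every object b of B sits in a distinguished triangle b' → b → c → b'[1] with b' in the essential image of Φ and c in the right orthogonal complement C = { c ∈ B : Hom(Φ(a), c) = 0 for all a ∈ A }, so that B = ⟨C, Φ(A)⟩ is a semiorthogonal decomposition. -/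
open CategoryTheory CategoryTheory.Pretriangulated CategoryTheory.Limits

/-- If a functor commutes with shifts, then every morphism from an object of its image to a
shifted object vanishes as soon as all morphisms to the unshifted object do. -/
lemma CategoryTheory.Functor.eq_zero_of_forall_hom_eq_zero
    {A : Type*} [Category A] [HasShift A ℤ]
    {B : Type*} [Category B] [Preadditive B] [HasShift B ℤ]
    [∀ n : ℤ, (shiftFunctor B n).Additive]
    (Φ : A ⥤ B) [Φ.CommShift ℤ] {c : B}
    (hc : ∀ (a : A) (φ : Φ.obj a ⟶ c), φ = 0)
    (a : A) (p : ℤ) (φ : Φ.obj a ⟶ c⟦p⟧) : φ = 0 := by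
  let i := (shiftFunctor A p).objObjPreimageIso a
  let e := (Φ.commShiftIso p).symm.app ((shiftFunctor A p).objPreimage a) ≪≫ Φ.mapIso i
  obtain ⟨ψ, hψ⟩ := (shiftFunctor B p).map_surjective (e.hom ≫ φ)
  rw [hc _ ψ, Functor.map_zero] at hψ
  exact (cancel_epi e.hom).1 (by rw [← hψ, comp_zero])

/-- A morphism from an object of the image of a full functor `Φ` with right adjoint `Ψ` to
`(Φ.obj (Ψ.obj b))⟦1⟧` is zero if its composition with the shifted counit is. -/
lemma CategoryTheory.Adjunction.eq_zero_of_comp_shift_counit_eq_zero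
    {A : Type*} [Category A] [Preadditive A] [HasShift A ℤ]
    {B : Type*} [Category B] [Preadditive B] [HasShift B ℤ]
    [∀ n : ℤ, (shiftFunctor B n).Additive]
    {Φ : A ⥤ B} [Φ.CommShift ℤ] [Φ.Additive] [Φ.Full]
    {Ψ : B ⥤ A} (adj : Φ ⊣ Ψ) {a : A} {b : B} (p : ℤ)
    (u : Φ.obj a ⟶ (Φ.obj (Ψ.obj b))⟦p⟧)
    (hu : u ≫ (adj.counit.app b)⟦p⟧' = 0) : u = 0 := by
  let i := (shiftFunctor A p).objObjPreimageIso a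
  let e := (Φ.commShiftIso p).symm.app ((shiftFunctor A p).objPreimage a) ≪≫ Φ.mapIso i
  obtain ⟨v, hv⟩ := (shiftFunctor B p).map_surjective (e.hom ≫ u)
  obtain ⟨w, rfl⟩ := Φ.map_surjective v
  have hw : Φ.map w ≫ adj.counit.app b = 0 := by
    apply (shiftFunctor B p).map_injective
    rw [Functor.map_comp, hv, Category.assoc, hu, comp_zero, Functor.map_zero]
  have hw' : w = 0 := by
    apply (adj.homEquiv _ _).symm.injective
    simp only [Adjunction.homEquiv_counit, hw, Functor.map_zero, zero_comp]
  rw [hw', Functor.map_zero, Functor.map_zero] at hv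
  exact (cancel_epi e.hom).1 (by rw [← hv, comp_zero])

/-- Bondal–Van den Bergh: let `Φ : A ⥤ B` be a fully faithful exact functor between
pretriangulated categories admitting a right adjoint `Ψ`.  For any object `b` of `B`,
if `Φ(Ψ(b)) → b → c → Φ(Ψ(b))[1]` is a distinguished triangle whose first map is the
counit, then `Hom(Φ(a), c[p]) = 0` for every object `a` of `A` and every integer `p`;
hence `c` lies in the right orthogonal complement of the image of `Φ` and
`B = ⟨C, Φ(A)⟩` is a semiorthogonal decomposition. -/
theorem sod_of_fullyFaithful_rightAdjoint
    (A : Type*) [Category A] [HasZeroObject A] [Preadditive A] [HasShift A ℤ]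
    [∀ n : ℤ, (shiftFunctor A n).Additive] [Pretriangulated A]
    (B : Type*) [Category B] [HasZeroObject B] [Preadditive B] [HasShift B ℤ]
    [∀ n : ℤ, (shiftFunctor B n).Additive] [Pretriangulated B]
    (Φ : A ⥤ B) [Φ.CommShift ℤ] [Φ.IsTriangulated]
    (hfull : Φ.Full) (hfaithful : Φ.Faithful)
    (Ψ : B ⥤ A) (adj : Φ ⊣ Ψ)
    (b c : B) (g : b ⟶ c) (h : c ⟶ (Φ.obj (Ψ.obj b))⟦(1 : ℤ)⟧)
    (hT : Triangle.mk (adj.counit.app b) g h ∈ distTriang B) :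
    ∀ (a : A) (p : ℤ) (φ : Φ.obj a ⟶ c⟦p⟧), φ = 0 := by
  refine Φ.eq_zero_of_forall_hom_eq_zero fun a φ ↦ ?_
  have hφ : φ ≫ h = 0 := by
    apply adj.eq_zero_of_comp_shift_counit_eq_zero
    rw [Category.assoc]
    have hh : h ≫ (adj.counit.app b)⟦(1 : ℤ)⟧' = 0 := comp_distTriang_mor_zero₃₁ _ hT
    rw [hh, comp_zero]
  obtain ⟨ψ, rfl⟩ : ∃ ψ : Φ.obj a ⟶ b, φ = ψ ≫ g := Triangle.coyoneda_exact₃ _ hT φ hφ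
  have hg : adj.counit.app b ≫ g = 0 := comp_distTriang_mor_zero₁₂ _ hT
  rw [← (adj.homEquiv a b).symm_apply_apply ψ, Adjunction.homEquiv_counit, Category.assoc, hg,
    comp_zero]
end

section
/- Let k be a field and let A and B be k-linear pretriangulated categories (triangulated categories with shift functor [1]) with finite-dimensional Hom-spaces, equipped with Serre functors S_A and S_B respectively. Let Φ : A → B be a k-linear exact functor (commuting with shifts up to natural isomorphism and sending distinguished triangles to distinguished triangles) which is fully faithful and admits a right adjoint, and assume there is a natural isomorphism Φ ∘ S_A ≅ S_B ∘ Φ. Assume moreover that every object b of B satisfying Hom(Φ(a), b[p]) = 0 and Hom(b, Φ(a)[p]) = 0 for all objects a of A and all integers p is a zero object. Then Φ is an equivalence of categories. -/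
open CategoryTheory CategoryTheory.Pretriangulated CategoryTheory.Limits

/-- A Serre functor on a `k`-linear category `A` with finite-dimensional Hom-spaces:
a `k`-linear auto-equivalence `S : A ⥤ A` together with isomorphisms
`f a b : Hom(a, b) ≃ₗ[k] Hom(b, S a)*`, natural in both `a` and `b`. -/
structure SerreFunctor (k : Type*) [Field k] (A : Type*) [Category A]
    [Preadditive A] [Linear k A] where
  S : A ⥤ A
  additive : S.Additive
  map_smul : ∀ {a b : A} (r : k) (g : a ⟶ b), S.map (r • g) = r • S.map g
  isEquivalence : S.IsEquivalence
  f : ∀ a b : A, (a ⟶ b) ≃ₗ[k] Module.Dual k (b ⟶ S.obj a)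
  nat_left : ∀ {a a' b : A} (g : a' ⟶ a) (u : a ⟶ b) (v : b ⟶ S.obj a'),
    f a' b (g ≫ u) v = f a b u (v ≫ S.map g)
  nat_right : ∀ {a b b' : A} (u : a ⟶ b) (h : b ⟶ b') (v : b' ⟶ S.obj a),
    f a b' (u ≫ h) v = f a b u (h ≫ v)

/-- If there are no nonzero morphisms `a ⟶ b`, then there are none `b ⟶ S a`. -/
theorem SerreFunctor.eq_zero_of_forall_eq_zero {k : Type*} [Field k] {A : Type*} [Category A]
    [Preadditive A] [Linear k A] (SA : SerreFunctor k A) {a b : A}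
    (h : ∀ u : a ⟶ b, u = 0) (v : b ⟶ SA.S.obj a) : v = 0 := by
  refine (Module.forall_dual_apply_eq_zero_iff k v).1 fun l => ?_
  obtain ⟨u, rfl⟩ := (SA.f a b).surjective l
  simp [h u]

/-- A morphism `Φ a ⟶ x⟦p⟧` is, up to an isomorphism of its source, the shift of a morphism
`Φ (a⟦-p⟧) ⟶ x`. -/
theorem exists_comp_eq_shift_map {A B : Type*} [Category A] [HasShift A ℤ]
    [Category B] [HasShift B ℤ] (Φ : A ⥤ B) [Φ.CommShift ℤ] {a : A} {x : B} (p : ℤ)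
    (φ : Φ.obj a ⟶ x⟦p⟧) :
    ∃ (e : (Φ.obj (a⟦-p⟧))⟦p⟧ ≅ Φ.obj a) (y : Φ.obj (a⟦-p⟧) ⟶ x), e.hom ≫ φ = y⟦p⟧' := by
  let e : (Φ.obj (a⟦-p⟧))⟦p⟧ ≅ Φ.obj a :=
    ((Φ.commShiftIso p).app (a⟦-p⟧)).symm ≪≫ Φ.mapIso (shiftNegShift a p)
  obtain ⟨y, hy⟩ := (shiftFunctor B p).map_surjective (e.hom ≫ φ)
  exact ⟨e, y, hy.symm⟩

/-- If all morphisms from the image of `Φ` to `x` vanish, then so do those to the shifts of `x`. -/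
theorem eq_zero_of_forall_eq_zero_of_shift {A B : Type*} [Category A] [HasShift A ℤ]
    [Category B] [Preadditive B] [HasShift B ℤ] [∀ n : ℤ, (shiftFunctor B n).Additive]
    (Φ : A ⥤ B) [Φ.CommShift ℤ] {x : B} (h : ∀ (a : A) (φ : Φ.obj a ⟶ x), φ = 0)
    (a : A) (p : ℤ) (φ : Φ.obj a ⟶ x⟦p⟧) : φ = 0 := by
  obtain ⟨e, y, hy⟩ := exists_comp_eq_shift_map Φ p φ
  rw [← cancel_epi e.hom, hy, h _ y, Functor.map_zero, comp_zero]

/-- For a full left adjoint `Φ`, composition with the counit is injective on morphisms from the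
image of `Φ`. -/
theorem eq_zero_of_comp_counit_eq_zero {A B : Type*} [Category A] [Preadditive A]
    [Category B] [Preadditive B] {Φ : A ⥤ B} [Φ.Additive] [Φ.Full] {Ψ : B ⥤ A} (adj : Φ ⊣ Ψ)
    {a : A} {b : B} (y : Φ.obj a ⟶ Φ.obj (Ψ.obj b)) (hy : y ≫ adj.counit.app b = 0) : y = 0 := by
  obtain ⟨z, rfl⟩ := Φ.map_surjective y
  have hz : z = 0 := by
    apply (adj.homEquiv a b).symm.injective
    rw [adj.homEquiv_counit, adj.homEquiv_counit, hy, Φ.map_zero, zero_comp]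
  rw [hz, Φ.map_zero]

/-- For a full exact left adjoint `Φ`, the cone of the counit is right orthogonal to the image
of `Φ`. -/
theorem eq_zero_of_counit_distinguished {A B : Type*}
    [Category A] [Preadditive A] [HasShift A ℤ]
    [Category B] [HasZeroObject B] [Preadditive B] [HasShift B ℤ]
    [∀ n : ℤ, (shiftFunctor B n).Additive] [Pretriangulated B]
    {Φ : A ⥤ B} [Φ.CommShift ℤ] [Φ.Additive] [Φ.Full] {Ψ : B ⥤ A} (adj : Φ ⊣ Ψ)
    {b c : B} {g : b ⟶ c} {h : c ⟶ (Φ.obj (Ψ.obj b))⟦(1 : ℤ)⟧}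
    (hT : Triangle.mk (adj.counit.app b) g h ∈ distTriang B)
    (a : A) (φ : Φ.obj a ⟶ c) : φ = 0 := by
  have hφ : φ ≫ h = 0 := by
    obtain ⟨e, y, hy⟩ := exists_comp_eq_shift_map Φ 1 (φ ≫ h)
    have hzero : h ≫ (adj.counit.app b)⟦(1 : ℤ)⟧' = 0 := comp_distTriang_mor_zero₃₁ _ hT
    have hy0 : y = 0 := by
      apply eq_zero_of_comp_counit_eq_zero adj
      apply (shiftFunctor B (1 : ℤ)).map_injective
      rw [Functor.map_comp, ← hy, Category.assoc, Category.assoc, hzero, comp_zero, comp_zero,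
        Functor.map_zero]
    rw [← cancel_epi e.hom, hy, hy0, Functor.map_zero, comp_zero]
  obtain ⟨ψ, hψ⟩ : ∃ ψ : Φ.obj a ⟶ b, φ = ψ ≫ g := Triangle.coyoneda_exact₃ _ hT φ hφ
  have hg : adj.counit.app b ≫ g = 0 := comp_distTriang_mor_zero₁₂ _ hT
  rw [hψ, ← (adj.homEquiv a b).symm_apply_apply ψ, adj.homEquiv_counit, Category.assoc, hg,
    comp_zero]

/-- If `Φ` commutes with Serre functors, an object right orthogonal to the image of `Φ` is also
left orthogonal to it. -/
theorem SerreFunctor.eq_zero_of_comm {k : Type*} [Field k]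
    {A : Type*} [Category A] [Preadditive A] [Linear k A]
    {B : Type*} [Category B] [Preadditive B] [Linear k B]
    (SA : SerreFunctor k A) (SB : SerreFunctor k B) {Φ : A ⥤ B}
    (comm : SA.S ⋙ Φ ≅ Φ ⋙ SB.S) {x : B} (h : ∀ (a : A) (φ : Φ.obj a ⟶ x), φ = 0)
    (a : A) (ψ : x ⟶ Φ.obj a) : ψ = 0 := by
  have := SA.isEquivalence
  let a' := SA.S.objPreimage a
  let e : Φ.obj a ≅ SB.S.obj (Φ.obj a') :=
    Φ.mapIso (SA.S.objObjPreimageIso a).symm ≪≫ comm.app a'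
  rw [← cancel_mono e.hom, zero_comp]
  exact SB.eq_zero_of_forall_eq_zero (h a') _

/-- Bridgeland's criterion for equivalence: a fully faithful exact functor `Φ` between
`k`-linear pretriangulated categories with finite-dimensional Hom-spaces and Serre
functors, admitting a right adjoint and compatible with the Serre functors
(`Φ ∘ S_A ≅ S_B ∘ Φ`), is an equivalence, provided that every object of `B`
orthogonal on both sides to the image of `Φ` is zero. -/
theorem equivalence_of_fullyFaithful_comm_serre (k : Type*) [Field k]
    (A : Type*) [Category A] [HasZeroObject A] [Preadditive A] [Linear k A]
    [HasShift A ℤ] [∀ n : ℤ, (shiftFunctor A n).Additive] [Pretriangulated A]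
    [∀ a b : A, FiniteDimensional k (a ⟶ b)]
    (B : Type*) [Category B] [HasZeroObject B] [Preadditive B] [Linear k B]
    [HasShift B ℤ] [∀ n : ℤ, (shiftFunctor B n).Additive] [Pretriangulated B]
    [∀ a b : B, FiniteDimensional k (a ⟶ b)]
    (SA : SerreFunctor k A) (SB : SerreFunctor k B)
    (Φ : A ⥤ B) [Φ.CommShift ℤ] [Φ.IsTriangulated]
    (hadd : Φ.Additive)
    (hsmul : ∀ {a b : A} (r : k) (g : a ⟶ b), Φ.map (r • g) = r • Φ.map g)
    (hfull : Φ.Full) (hfaithful : Φ.Faithful)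
    (Ψ : B ⥤ A) (adj : Φ ⊣ Ψ)
    (comm : SA.S ⋙ Φ ≅ Φ ⋙ SB.S)
    (hnondeg : ∀ b : B,
      (∀ (a : A) (p : ℤ) (φ : Φ.obj a ⟶ b⟦p⟧), φ = 0) →
      (∀ (a : A) (p : ℤ) (ψ : b ⟶ (Φ.obj a)⟦p⟧), ψ = 0) → IsZero b) :
    Φ.IsEquivalence := by
  have hcounit (b : B) : IsIso (adj.counit.app b) := by
    obtain ⟨c, g, h, hT⟩ := distinguished_cocone_triangle (adj.counit.app b)
    have hright := eq_zero_of_counit_distinguished adj hT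
    have hc : IsZero c := by
      refine hnondeg c (eq_zero_of_forall_eq_zero_of_shift Φ hright) fun a p ψ => ?_
      rw [← cancel_mono ((Φ.commShiftIso p).app a).inv, zero_comp]
      exact SA.eq_zero_of_comm SB comm hright _ _
    exact (Triangle.isZero₃_iff_isIso₁ _ hT).1 hc
  have : IsIso adj.counit := NatIso.isIso_of_isIso_app _
  exact adj.toEquivalence.isEquivalence_functor
end

section
/- Let A and B be pretriangulated categories (triangulated categories with shift functor [1]) and let F : A → B be an exact functor (commuting with shifts up to natural isomorphism and sending distinguished triangles to distinguished triangles) admitting both a left adjoint and a right adjoint. Let Ω be a spanning class of A. If for all ω, ω' ∈ Ω and all integers p the map induced by F from Hom(ω, ω'[p]) to Hom(F(ω), F(ω')[p]) is bijective, then F is fully faithful. -/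
open CategoryTheory CategoryTheory.Pretriangulated CategoryTheory.Limits

namespace SpanningClass

variable {A : Type*} [Category A] [HasZeroObject A] [Preadditive A] [HasShift A ℤ]
  [∀ n : ℤ, (shiftFunctor A n).Additive] [Pretriangulated A]

/-- A morphism is an isomorphism if it is inverted by all `Hom(-, ω[p])`, for `ω` in a class
detecting zero objects through morphisms into its shifts. -/
lemma isIso_of_precomp_bijective {Ω : Set A}
    (hΩ : ∀ a : A, (∀ ω ∈ Ω, ∀ (p : ℤ) (f : a ⟶ ω⟦p⟧), f = 0) → IsZero a)
    {X Y : A} (φ : X ⟶ Y)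
    (hφ : ∀ ω ∈ Ω, ∀ p : ℤ, Function.Bijective (fun f : Y ⟶ ω⟦p⟧ => φ ≫ f)) :
    IsIso φ := by
  obtain ⟨C, g, δ, hT⟩ := distinguished_cocone_triangle φ
  suffices IsZero C from (Triangle.isZero₃_iff_isIso₁ _ hT).1 this
  refine hΩ C fun ω hω p f => ?_
  have comp_zero₁₂ : φ ≫ g = 0 := comp_distTriang_mor_zero₁₂ _ hT
  have comp_zero₃₁ : δ ≫ φ⟦(1 : ℤ)⟧' = 0 := comp_distTriang_mor_zero₃₁ _ hT
  have hf : g ≫ f = 0 := (hφ ω hω p).1 (by simp [reassoc_of% comp_zero₁₂])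
  obtain ⟨h, rfl⟩ : ∃ h : X⟦(1 : ℤ)⟧ ⟶ ω⟦p⟧, f = δ ≫ h := Triangle.yoneda_exact₃ _ hT f hf
  let e := (shiftFunctorAdd' A (p - 1) 1 p (by lia)).app ω
  obtain ⟨h', hh'⟩ := (shiftFunctor A (1 : ℤ)).map_surjective (h ≫ e.hom)
  obtain ⟨k, rfl⟩ := (hφ ω hω (p - 1)).2 h'
  rw [← cancel_mono e.hom, Category.assoc, ← hh']
  simp [reassoc_of% comp_zero₃₁]

/-- A morphism is an isomorphism if it is inverted by all `Hom(ω, -[p])`, for `ω` in a class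
detecting zero objects through morphisms into their shifts. -/
lemma isIso_of_postcomp_shift_bijective {Ω : Set A}
    (hΩ : ∀ a : A, (∀ ω ∈ Ω, ∀ (p : ℤ) (f : ω ⟶ a⟦p⟧), f = 0) → IsZero a)
    {X Y : A} (φ : X ⟶ Y)
    (hφ : ∀ ω ∈ Ω, ∀ p : ℤ, Function.Bijective (fun f : ω ⟶ X⟦p⟧ => f ≫ φ⟦p⟧')) :
    IsIso φ := by
  obtain ⟨C, g, δ, hT⟩ := distinguished_cocone_triangle φ
  suffices IsZero C from (Triangle.isZero₃_iff_isIso₁ _ hT).1 this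
  refine hΩ C fun ω hω p f => ?_
  have comp_zero₁₂ : φ ≫ g = 0 := comp_distTriang_mor_zero₁₂ _ hT
  have comp_zero₃₁ : δ ≫ φ⟦(1 : ℤ)⟧' = 0 := comp_distTriang_mor_zero₃₁ _ hT
  let e := shiftFunctorAdd' A 1 p (p + 1) (by lia)
  have hfδ : f ≫ δ⟦p⟧' = 0 := by
    rw [← cancel_mono (e.inv.app X), zero_comp]
    refine (hφ ω hω (p + 1)).1 ?_
    have naturality := e.inv.naturality φ
    dsimp at naturality ⊢
    rw [Category.assoc, Category.assoc, ← naturality, ← Functor.map_comp_assoc, comp_zero₃₁]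
    simp
  obtain ⟨k, hk⟩ : ∃ k : ω ⟶ Y⟦p⟧, f = k ≫ g⟦p⟧' := by
    obtain ⟨k, hk⟩ : ∃ k : ω ⟶ Y⟦p⟧, f = k ≫ (p.negOnePow • g⟦p⟧') :=
      Triangle.coyoneda_exact₃ _ (Triangle.shift_distinguished _ hT p) f
        (show f ≫ (p.negOnePow • δ⟦p⟧' ≫ (shiftFunctorComm A 1 p).hom.app X) = 0 by
          simp [reassoc_of% hfδ])
    exact ⟨p.negOnePow • k, by rw [hk, Linear.units_smul_comp, Linear.comp_units_smul]⟩
  obtain ⟨l, rfl⟩ := (hφ ω hω p).2 k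
  rw [hk]
  simp [← Functor.map_comp, comp_zero₁₂]

end SpanningClass

/-- Bridgeland's criterion: let `F : A ⥤ B` be an exact functor between
pretriangulated categories admitting both a left adjoint and a right adjoint, and let
`Ω` be a spanning class of `A` (conditions `hΩ₁`, `hΩ₂`).  If `F` induces bijections
`Hom(ω, ω'[p]) → Hom(F ω, F ω'[p])` for all `ω, ω' ∈ Ω` and all integers `p`,
then `F` is fully faithful. -/
theorem fullyFaithful_of_spanningClass
    (A : Type*) [Category A] [HasZeroObject A] [Preadditive A] [HasShift A ℤ]
    [∀ n : ℤ, (shiftFunctor A n).Additive] [Pretriangulated A]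
    (B : Type*) [Category B] [HasZeroObject B] [Preadditive B] [HasShift B ℤ]
    [∀ n : ℤ, (shiftFunctor B n).Additive] [Pretriangulated B]
    (F : A ⥤ B) [F.CommShift ℤ] [F.IsTriangulated]
    (G : B ⥤ A) (adjL : G ⊣ F) (H : B ⥤ A) (adjR : F ⊣ H)
    (Ω : Set A)
    (hΩ₁ : ∀ a : A, (∀ ω ∈ Ω, ∀ (p : ℤ) (f : ω ⟶ a⟦p⟧), f = 0) → IsZero a)
    (hΩ₂ : ∀ a : A, (∀ ω ∈ Ω, ∀ (p : ℤ) (f : a ⟶ ω⟦p⟧), f = 0) → IsZero a)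
    (hbij : ∀ ω ∈ Ω, ∀ ω' ∈ Ω, ∀ p : ℤ,
      Function.Bijective (fun u : ω ⟶ ω'⟦p⟧ =>
        F.map u ≫ (F.commShiftIso p).hom.app ω')) :
    F.Full ∧ F.Faithful := by
  have isIso_counit (ω) (hω : ω ∈ Ω) : IsIso (adjL.counit.app ω) := by
    refine SpanningClass.isIso_of_precomp_bijective hΩ₂ _ fun ω' hω' p => ?_
    have map_bijective : Function.Bijective (fun u : ω ⟶ ω'⟦p⟧ => F.map u) :=
      (Function.Bijective.of_comp_iff' ((F.commShiftIso p).app ω').homToEquiv.bijective _).1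
        (hbij ω hω ω' hω' p)
    refine (congrArg Function.Bijective (funext fun u => ?_)).mpr
      ((adjL.homEquiv (F.obj ω) (ω'⟦p⟧)).symm.bijective.comp map_bijective)
    simp [Adjunction.homEquiv_counit]
  have map_bijective (ω) (hω : ω ∈ Ω) (X : A) :
      Function.Bijective (fun u : ω ⟶ X => F.map u) := by
    have := isIso_counit ω hω
    refine (congrArg Function.Bijective (funext fun u => ?_)).mpr
      ((adjL.homEquiv (F.obj ω) X).bijective.comp
        ((asIso (adjL.counit.app ω)).symm.homFromEquiv (Z := X)).bijective)
    simp [Adjunction.homEquiv_unit]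
  let _ := adjR.rightAdjointCommShift ℤ
  have := adjR.commShift_of_leftAdjoint ℤ
  have isIso_unit (X : A) : IsIso (adjR.unit.app X) := by
    refine SpanningClass.isIso_of_postcomp_shift_bijective hΩ₁ _ fun ω hω p => ?_
    let e : H.obj (F.obj (X⟦p⟧)) ≅ (H.obj (F.obj X))⟦p⟧ :=
      H.mapIso ((F.commShiftIso p).app X) ≪≫ (H.commShiftIso p).app (F.obj X)
    refine (congrArg Function.Bijective (funext fun u => ?_)).mpr
      ((e.homToEquiv (Z := ω)).bijective.comp
        ((adjR.homEquiv ω (F.obj (X⟦p⟧))).bijective.comp (map_bijective ω hω (X⟦p⟧))))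
    simp [e, Adjunction.homEquiv_unit, adjR.shift_unit_app]
  have : IsIso adjR.unit := NatIso.isIso_of_isIso_app _
  exact ⟨adjR.fullyFaithfulLOfIsIsoUnit.full, adjR.fullyFaithfulLOfIsIsoUnit.faithful⟩
end
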